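/- arXiv:2603.15285 — 2 statements merged into one kernel-verified Lean document; each statement's English description precedes it below -/
import Mathlib

section
/- Let X be a compact topological space, let F, G : X → ℝ be continuous, and let S ⊆ X be a compact subset with positive set gap Γ_F(S) > 0. If sup_{x ∈ X} |F(x) − G(x)| ≤ ε and 2ε < Γ_F(S), then G attains its maximum on X and every global maximizer of G lies in S. -/
/-- Set-gap stability: if `sup |F - G| ≤ ε` and `2ε < Γ_F(S)` where
`Γ_F(S) = max_{x ∈ S} F x - sup_{x ∉ S} F x`, then `G` attains its maximum
on the compact space `X` and every global maximizer of `G` lies in `S`. -/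
theorem setgap_stability
    {X : Type*} [TopologicalSpace X] [CompactSpace X]
    (F G : X → ℝ) (hF : Continuous F) (hG : Continuous G)
    (S : Set X) (hS : IsCompact S) (hSne : S.Nonempty)
    (ε : ℝ)
    (hgap : 0 < sSup (F '' S) - sSup (F '' Sᶜ))
    (hclose : ∀ x, |F x - G x| ≤ ε)
    (hε : 2 * ε < sSup (F '' S) - sSup (F '' Sᶜ)) :
    (∃ x, ∀ y, G y ≤ G x) ∧
      (∀ x, (∀ y, G y ≤ G x) → x ∈ S) := by
  obtain ⟨s, hs, hsmax⟩ := hS.exists_sSup_image_eq hSne hF.continuousOn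
  refine ⟨?_, fun x hx => ?_⟩
  · obtain ⟨x, -, hx⟩ := isCompact_univ.exists_isMaxOn ⟨s, Set.mem_univ s⟩ hG.continuousOn
    exact ⟨x, fun y => hx (Set.mem_univ y)⟩
  · by_contra hxS
    have hbdd : BddAbove (F '' Sᶜ) :=
      (isCompact_range hF).bddAbove.mono (Set.image_subset_range F Sᶜ)
    have hFx : F x ≤ sSup (F '' Sᶜ) := le_csSup hbdd ⟨x, hxS, rfl⟩
    have hx' := abs_le.mp (hclose x)
    have hs' := abs_le.mp (hclose s)
    linarith [hx s, hx'.1, hs'.2]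
end

section
/- Let n ≥ 1, let K ⊆ ℝⁿ be compact, let r > 0, and let g₁, …, g_P ∈ ℝⁿ be such that the closed balls U_p := B̄(g_p, r) are pairwise disjoint and contained in K; set S := ∪_{p=1}^P U_p. Let F₀, E₁, …, E_J : ℝⁿ → ℝ be twice continuously differentiable on an open set containing K, and set F_j := F₀ + ∑_{k=1}^{j} E_k, a_j := sup_{x ∈ S} ‖∇E_j(x)‖, b_j := sup_{x ∈ S} ‖D²E_j(x)‖_op, δ_j := sup_{x ∈ K} |E_j(x)|. Assume: (A) for each p, F₀ is μ-strongly concave on U_p (μ > 0) and g_p is the unique maximizer of F₀ on U_p; (B) ∑_j b_j ≤ μ/2, a_j < μr/8 for every j, and ∑_j 2a_j/μ ≤ r/2; (C) the set gap of F₀ relative to K, Γ := max_{x ∈ S} F₀(x) − sup_{x ∈ K∖S} F₀(x), satisfies Γ > 0 and 2∑_j δ_j < Γ; (D) for each p, let m_{p,J} denote the unique maximizer of F_J on U_p (which exists by (A)–(B)), and let g_p^{(J)} ∈ ℝⁿ satisfy ‖g_p^{(J)} − m_{p,J}‖ ≤ τ with τ ≤ r/2; (E) there is a unique p★ maximizing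 p ↦ F_J(m_{p,J}), with gap γ := F_J(m_{p★,J}) − max_{p ≠ p★} F_J(m_{p,J}) > 0; (F) M_J := sup_{x ∈ S} ‖D²F_J(x)‖_op satisfies (M_J/2)·τ² ≤ γ/4. Then the output ĝ := g_{p̂}^{(J)} with p̂ ∈ argmax_p F_J(g_p^{(J)}) satisfies p̂ = p★, ‖ĝ − m_{p★,J}‖ ≤ τ, and 0 ≤ max_{x ∈ K} F_J(x) − F_J(ĝ) ≤ (M_J/2)·τ². -/
section Calculus

variable {E : Type*} [NormedAddCommGroup E]

/-- One-sided quadratic bounds on the second derivative integrate to the gradient map. -/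
lemma fderiv_sub_apply_le [NormedSpace ℝ E] {f : E → ℝ} {s : Set E} (hs : Convex ℝ s) {c : ℝ}
    (hf : ∀ z ∈ s, ContDiffAt ℝ 2 f z) {x y : E} (hx : x ∈ s) (hy : y ∈ s)
    (hc : ∀ z ∈ s, fderiv ℝ (fderiv ℝ f) z (y - x) (y - x) ≤ c) :
    fderiv ℝ f y (y - x) - fderiv ℝ f x (y - x) ≤ c := by
  have hd : ∀ z ∈ s, HasFDerivWithinAt (fun w => fderiv ℝ f w (y - x))
      ((fderiv ℝ (fderiv ℝ f) z).flip (y - x)) s z := by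
    intro z hz
    have h1 : DifferentiableAt ℝ (fderiv ℝ f) z :=
      ((hf z hz).fderiv_right (m := 1) (by norm_num)).differentiableAt (by norm_num)
    have h2 := h1.hasFDerivAt.clm_apply (hasFDerivAt_const (y - x) z)
    refine (h2.congr_fderiv ?_).hasFDerivWithinAt
    ext v
    simp
  obtain ⟨z, hz, h⟩ := domain_mvt hd hs hx hy
  rw [h]
  exact hc z (hs.segment_subset hx hy hz)

/-- Quadratic growth bound around a critical point with bounded second derivative. -/
lemma sub_le_of_fderiv_eq_zero [InnerProductSpace ℝ E] {f : E → ℝ} {s : Set E}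
    (hs : Convex ℝ s) {M : ℝ} (hf : ∀ z ∈ s, ContDiffAt ℝ 2 f z)
    (hM : ∀ z ∈ s, ‖fderiv ℝ (fderiv ℝ f) z‖ ≤ M) {x y : E} (hx : x ∈ s) (hy : y ∈ s)
    (h0 : fderiv ℝ f x = 0) : f x - f y ≤ M / 2 * ‖y - x‖ ^ 2 := by
  have hd : ∀ z ∈ s, HasFDerivWithinAt (fun w => f w + M / 2 * ‖w - x‖ ^ 2)
      (fderiv ℝ f z + (M / 2) • (2 • innerSL ℝ (z - x))) s z := by
    intro z hz
    have h1 : HasFDerivAt f (fderiv ℝ f z) z :=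
      ((hf z hz).differentiableAt (by norm_num)).hasFDerivAt
    have h2 := ((hasFDerivAt_id z).sub_const x).norm_sq.const_mul (M / 2)
    exact (h1.add (h2.congr_fderiv (by ext v; simp))).hasFDerivWithinAt
  obtain ⟨z, hz, h⟩ := domain_mvt hd hs hx hy
  have hzs := hs.segment_subset hx hy hz
  have hg : ‖fderiv ℝ f z‖ ≤ M * ‖z - x‖ := by
    have := hs.norm_image_sub_le_of_norm_fderiv_le (𝕜 := ℝ) (f := fderiv ℝ f)
      (fun w hw => ((hf w hw).fderiv_right (m := 1) (by norm_num)).differentiableAt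
        (by norm_num)) hM hx hzs
    simpa [h0] using this
  rw [segment_eq_image'] at hz
  obtain ⟨t, ht, rfl⟩ := hz
  have hg' : -(fderiv ℝ f (x + t • (y - x)) (y - x)) ≤ M * t * ‖y - x‖ ^ 2 := by
    calc _ ≤ ‖fderiv ℝ f (x + t • (y - x)) (y - x)‖ := neg_le_abs _
      _ ≤ ‖fderiv ℝ f (x + t • (y - x))‖ * ‖y - x‖ := ContinuousLinearMap.le_opNorm _ _
      _ ≤ M * ‖x + t • (y - x) - x‖ * ‖y - x‖ := by gcongr
      _ = M * t * ‖y - x‖ ^ 2 := by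
        rw [add_sub_cancel_left, norm_smul, Real.norm_of_nonneg ht.1]; ring
  simp only [sub_self, norm_zero, add_sub_cancel_left, add_apply, smul_apply, innerSL_apply_apply,
    inner_smul_left, real_inner_self_eq_norm_sq, smul_eq_mul, nsmul_eq_mul, conj_trivial,
    Nat.cast_ofNat] at h
  linarith

end Calculus


/-- Main theorem (Euclidean, compact-ambient version): correctness of the
frequency-marching scheme. Under basin strong-concavity (A), spectral-decay
budgets (B), a set-gap condition (C), a Newton tolerance (D), and winner-gap
conditions (E)-(F), the returned candidate equals the winning basin's iterate,
lies within `τ` of the global maximizer of `F_J` on `K`, and its value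
suboptimality is at most `(M_J/2) τ²`. -/
theorem matcha_main_theorem
    {n : ℕ} (hn : 1 ≤ n)
    (K : Set (EuclideanSpace ℝ (Fin n))) (hK : IsCompact K)
    (r : ℝ) (hr : 0 < r)
    {P : ℕ} (hP : 1 ≤ P) (g : Fin P → EuclideanSpace ℝ (Fin n))
    (hdisj : Pairwise fun p q => Disjoint (Metric.closedBall (g p) r) (Metric.closedBall (g q) r))
    (hsub : ∀ p, Metric.closedBall (g p) r ⊆ K)
    (V : Set (EuclideanSpace ℝ (Fin n))) (hV : IsOpen V) (hKV : K ⊆ V)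
    (J : ℕ) (F₀ : EuclideanSpace ℝ (Fin n) → ℝ)
    (Ek : ℕ → EuclideanSpace ℝ (Fin n) → ℝ)
    (hF₀ : ContDiffOn ℝ 2 F₀ V) (hEk : ∀ k < J, ContDiffOn ℝ 2 (Ek k) V)
    (μ : ℝ) (hμ : 0 < μ)
    -- (A): per-basin strong concavity and unique maximizer of F₀
    (hconc : ∀ p, ∀ x ∈ Metric.closedBall (g p) r, ∀ v,
      fderiv ℝ (fderiv ℝ F₀) x v v ≤ -μ * ‖v‖ ^ 2)
    (hmax0 : ∀ p, ∀ x ∈ Metric.closedBall (g p) r, F₀ x ≤ F₀ (g p))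
    (huniq0 : ∀ p, ∀ x ∈ Metric.closedBall (g p) r,
      (∀ y ∈ Metric.closedBall (g p) r, F₀ y ≤ F₀ x) → x = g p)
    -- (B): spectral-decay budgets on S = ⋃ p, U_p and on K
    (a b δ : ℕ → ℝ)
    (hgrad : ∀ k < J, ∀ x ∈ ⋃ p, Metric.closedBall (g p) r, ‖fderiv ℝ (Ek k) x‖ ≤ a k)
    (hhess : ∀ k < J, ∀ x ∈ ⋃ p, Metric.closedBall (g p) r,
      ‖fderiv ℝ (fderiv ℝ (Ek k)) x‖ ≤ b k)
    (hδ : ∀ k < J, ∀ x ∈ K, |Ek k x| ≤ δ k)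
    (hbsum : ∑ k ∈ Finset.range J, b k ≤ μ / 2)
    (hagrad : ∀ k < J, a k < μ * r / 8)
    (hasum : ∑ k ∈ Finset.range J, 2 * a k / μ ≤ r / 2)
    -- (C): set gap of F₀ relative to K with respect to S
    (hgap0 : 0 < sSup (F₀ '' (⋃ p, Metric.closedBall (g p) r))
      - sSup (F₀ '' (K \ ⋃ p, Metric.closedBall (g p) r)))
    (hδsum : 2 * ∑ k ∈ Finset.range J, δ k
      < sSup (F₀ '' (⋃ p, Metric.closedBall (g p) r))
        - sSup (F₀ '' (K \ ⋃ p, Metric.closedBall (g p) r)))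
    -- (D): per-basin maximizers of F_J and Newton iterates within tolerance τ
    (m gJ : Fin P → EuclideanSpace ℝ (Fin n))
    (hm : ∀ p, m p ∈ Metric.closedBall (g p) r)
    (hmmax : ∀ p, ∀ x ∈ Metric.closedBall (g p) r,
      F₀ x + ∑ k ∈ Finset.range J, Ek k x ≤ F₀ (m p) + ∑ k ∈ Finset.range J, Ek k (m p))
    (hmuniq : ∀ p, ∀ x ∈ Metric.closedBall (g p) r,
      (∀ y ∈ Metric.closedBall (g p) r,
        F₀ y + ∑ k ∈ Finset.range J, Ek k y ≤ F₀ x + ∑ k ∈ Finset.range J, Ek k x)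
        → x = m p)
    (τ : ℝ) (hτ : τ ≤ r / 2)
    (hgJ : ∀ p, ‖gJ p - m p‖ ≤ τ)
    -- (E): unique winning basin with inter-basin gap γ
    (pstar : Fin P) (γ : ℝ) (hγ : 0 < γ)
    (hγgap : ∀ p, p ≠ pstar →
      F₀ (m p) + ∑ k ∈ Finset.range J, Ek k (m p)
        ≤ F₀ (m pstar) + ∑ k ∈ Finset.range J, Ek k (m pstar) - γ)
    -- (F): curvature bound and Newton-tolerance-vs-gap condition
    (MJ : ℝ)
    (hMJ : ∀ x ∈ ⋃ p, Metric.closedBall (g p) r,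
      ‖fderiv ℝ (fderiv ℝ (fun y => F₀ y + ∑ k ∈ Finset.range J, Ek k y)) x‖ ≤ MJ)
    (hτγ : MJ / 2 * τ ^ 2 ≤ γ / 4) :
    ∀ phat : Fin P,
      (∀ p, F₀ (gJ p) + ∑ k ∈ Finset.range J, Ek k (gJ p)
        ≤ F₀ (gJ phat) + ∑ k ∈ Finset.range J, Ek k (gJ phat)) →
      phat = pstar ∧
      ‖gJ phat - m pstar‖ ≤ τ ∧
      0 ≤ sSup ((fun y => F₀ y + ∑ k ∈ Finset.range J, Ek k y) '' K)
        - (F₀ (gJ phat) + ∑ k ∈ Finset.range J, Ek k (gJ phat)) ∧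
      sSup ((fun y => F₀ y + ∑ k ∈ Finset.range J, Ek k y) '' K)
        - (F₀ (gJ phat) + ∑ k ∈ Finset.range J, Ek k (gJ phat)) ≤ MJ / 2 * τ ^ 2 := by
  set F : EuclideanSpace ℝ (Fin n) → ℝ :=
    fun y => F₀ y + ∑ k ∈ Finset.range J, Ek k y with hF
  have hUV : ∀ p, ∀ x ∈ Metric.closedBall (g p) r, V ∈ nhds x := fun p x hx =>
    hV.mem_nhds (hKV (hsub p hx))
  have hFC : ContDiffOn ℝ 2 F V :=
    hF₀.add (ContDiffOn.sum fun k hk => hEk k (Finset.mem_range.1 hk))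
  have hUS : ∀ p, ∀ x ∈ Metric.closedBall (g p) r, x ∈ ⋃ q, Metric.closedBall (g q) r :=
    fun p x hx => Set.mem_iUnion.2 ⟨p, hx⟩
  have hFd : ∀ p, ∀ x ∈ Metric.closedBall (g p) r,
      fderiv ℝ F x = fderiv ℝ F₀ x + ∑ k ∈ Finset.range J, fderiv ℝ (Ek k) x := by
    intro p x hx
    have h0 := ((hF₀.contDiffAt (hUV p x hx)).differentiableAt (by norm_num)).hasFDerivAt
    have h1 : ∀ k ∈ Finset.range J, HasFDerivAt (Ek k) (fderiv ℝ (Ek k) x) x := fun k hk =>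
      (((hEk k (Finset.mem_range.1 hk)).contDiffAt (hUV p x hx)).differentiableAt
        (by norm_num)).hasFDerivAt
    exact (h0.add (HasFDerivAt.fun_sum h1)).fderiv
  have hgU : ∀ p, g p ∈ Metric.closedBall (g p) r := fun p => Metric.mem_closedBall_self hr.le
  -- the basin maximizers move by at most half a radius
  have hmg : ∀ p, ‖m p - g p‖ ≤ r / 2 := by
    intro p
    have hconv := convex_closedBall (g p) r
    have hcrit : fderiv ℝ F₀ (g p) = 0 :=
      IsLocalMax.fderiv_eq_zero
        (Filter.eventually_of_mem (Metric.closedBall_mem_nhds (g p) hr) (hmax0 p))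
    have hF₀mono := fderiv_sub_apply_le hconv
      (fun z hz => hF₀.contDiffAt (hUV p z hz)) (hgU p) (hm p)
      (fun z hz => hconc p z hz (m p - g p))
    have hEmono : ∀ k ∈ Finset.range J, fderiv ℝ (Ek k) (m p) (m p - g p) ≤
        b k * ‖m p - g p‖ ^ 2 + a k * ‖m p - g p‖ := by
      intro k hk
      have hk' := Finset.mem_range.1 hk
      have h1 := fderiv_sub_apply_le hconv
        (fun z hz => (hEk k hk').contDiffAt (hUV p z hz)) (hgU p) (hm p)
        (c := b k * ‖m p - g p‖ ^ 2) (fun z hz => by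
          refine (le_abs_self _).trans ((ContinuousLinearMap.le_opNorm₂
            (fderiv ℝ (fderiv ℝ (Ek k)) z) (m p - g p) (m p - g p)).trans ?_)
          rw [mul_assoc, ← sq]
          gcongr
          exact hhess k hk' z (hUS p z hz))
      have h2 : fderiv ℝ (Ek k) (g p) (m p - g p) ≤ a k * ‖m p - g p‖ :=
        (le_abs_self _).trans ((ContinuousLinearMap.le_opNorm _ _).trans
          (mul_le_mul_of_nonneg_right
          (hgrad k hk' _ (hUS p _ (hgU p))) (norm_nonneg _)))
      linarith
    have hsum := Finset.sum_le_sum hEmono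
    rw [Finset.sum_add_distrib, ← Finset.sum_mul, ← Finset.sum_mul] at hsum
    have hfirst : fderiv ℝ F (m p) (g p - m p) ≤ 0 := by
      have hmax : IsLocalMaxOn F (Metric.closedBall (g p) r) (m p) :=
        IsMaxOn.localize (hmmax p)
      exact hmax.hasFDerivWithinAt_nonpos
        ((hFC.contDiffAt (hUV p _ (hm p))).differentiableAt
          (by norm_num)).hasFDerivAt.hasFDerivWithinAt
        (sub_mem_posTangentConeAt_of_segment_subset (hconv.segment_subset (hm p) (hgU p)))
    rw [hFd p _ (hm p), ← neg_sub (m p) (g p), map_neg] at hfirst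
    simp only [add_apply, sum_apply] at hfirst
    rw [hcrit] at hF₀mono
    simp only [zero_apply, sub_zero] at hF₀mono
    have hA : ∑ k ∈ Finset.range J, a k ≤ μ * r / 4 := by
      rw [← Finset.sum_div, ← Finset.mul_sum, div_le_iff₀ hμ] at hasum
      linarith
    have hd := norm_nonneg (m p - g p)
    set d := ‖m p - g p‖
    have hb : (∑ k ∈ Finset.range J, b k) * d ^ 2 ≤ μ / 2 * d ^ 2 := by gcongr
    have ha : (∑ k ∈ Finset.range J, a k) * d ≤ μ * r / 4 * d := by gcongr
    by_contra! hlt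
    have hdpos : 0 < d := by linarith
    nlinarith [mul_pos (mul_pos hμ hdpos) (sub_pos.2 hlt)]
  have hgU' : ∀ p, gJ p ∈ Metric.closedBall (g p) r := by
    intro p
    rw [mem_closedBall_iff_norm]
    have := norm_add_le (gJ p - m p) (m p - g p)
    rw [sub_add_sub_cancel] at this
    linarith [hgJ p, hmg p]
  have hτ0 : 0 ≤ τ := (norm_nonneg _).trans (hgJ pstar)
  have hMJ0 : 0 ≤ MJ :=
    (norm_nonneg (fderiv ℝ (fderiv ℝ F) (g pstar))).trans (hMJ _ (hUS pstar _ (hgU pstar)))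
  have hval : ∀ p, F (m p) - F (gJ p) ≤ MJ / 2 * τ ^ 2 := by
    intro p
    have hcrit : fderiv ℝ F (m p) = 0 := by
      refine IsLocalMax.fderiv_eq_zero (Filter.eventually_of_mem
        (Metric.closedBall_mem_nhds_of_mem ?_) (hmmax p))
      rw [mem_ball_iff_norm]
      linarith [hmg p]
    refine (sub_le_of_fderiv_eq_zero (convex_closedBall (g p) r)
      (fun z hz => hFC.contDiffAt (hUV p z hz)) (fun z hz => hMJ z (hUS p z hz))
      (hm p) (hgU' p) hcrit).trans ?_
    gcongr
    exact hgJ p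
  have hbest : ∀ p, F (m p) ≤ F (m pstar) := by
    intro p
    by_cases hp : p = pstar
    · rw [hp]
    · exact (hγgap p hp).trans (sub_le_self _ hγ.le)
  have hE : ∀ x ∈ K, |F x - F₀ x| ≤ ∑ k ∈ Finset.range J, δ k := by
    intro x hx
    rw [hF, add_sub_cancel_left]
    exact (Finset.abs_sum_le_sum_abs _ _).trans
      (Finset.sum_le_sum fun k hk => hδ k (Finset.mem_range.1 hk) x hx)
  have hglobal : ∀ x ∈ K, F x ≤ F (m pstar) := by
    intro x hx
    by_cases hxS : x ∈ ⋃ p, Metric.closedBall (g p) r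
    · obtain ⟨p, hp⟩ := Set.mem_iUnion.1 hxS
      exact (hmmax p x hp).trans (hbest p)
    · have hbdd : BddAbove (F₀ '' (K \ ⋃ p, Metric.closedBall (g p) r)) :=
        (hK.bddAbove_image (hF₀.continuousOn.mono hKV)).mono (Set.image_mono Set.sdiff_subset)
      have hxle := le_csSup hbdd (Set.mem_image_of_mem F₀ ⟨hx, hxS⟩)
      obtain ⟨_, ⟨y, hy, rfl⟩, hlt⟩ := exists_lt_of_lt_csSup
        (Set.Nonempty.image F₀ ⟨_, hUS pstar _ (hgU pstar)⟩) (lt_sub_iff_add_lt.1 hδsum)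
      obtain ⟨p, hp⟩ := Set.mem_iUnion.1 hy
      have h1 := abs_le.1 (hE x hx)
      have h2 := abs_le.1 (hE y (hsub p hp))
      have h3 : F y ≤ F (m p) := hmmax p y hp
      linarith [hbest p, h1.2, h2.1]
  intro phat hphat
  have hwin : phat = pstar := by
    by_contra hne
    have h1 : F (gJ phat) ≤ F (m phat) := hmmax phat _ (hgU' phat)
    have h2 : F (m phat) ≤ F (m pstar) - γ := hγgap phat hne
    have h3 : F (gJ pstar) ≤ F (gJ phat) := hphat pstar
    linarith [hval pstar]
  subst hwin
  have hmK := hsub phat (hm phat)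
  have hsup : sSup (F '' K) = F (m phat) :=
    IsGreatest.csSup_eq ⟨Set.mem_image_of_mem F hmK, Set.forall_mem_image.2 hglobal⟩
  rw [hsup]
  exact ⟨rfl, hgJ phat, sub_nonneg.2 (hglobal _ (hsub phat (hgU' phat))), hval phat⟩
end
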